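/- Let M and k be positive integers and let f be a nonzero cusp form of weight k for the congruence subgroup Γ₁(M). Then for any finite set S of distinct positive integers, the family of functions ℍ → ℂ given by τ ↦ f(n·τ), indexed by n ∈ S, is linearly independent over ℂ. (In particular, if f is a newform of level M dividing N, the functions f(nτ) for n running through the divisors of N/M are linearly independent.) -/

import Mathlib

open CongruenceSubgroup UpperHalfPlane

open scoped MatrixGroups

/-- For `n > 0`, multiplication by `n` maps the upper half plane to itself. -/
noncomputable def UpperHalfPlane.scaleNat (n : ℕ) (hn : 0 < n) (z : UpperHalfPlane) :
    UpperHalfPlane :=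
  ⟨(n : ℂ) * (z : ℂ), by
    simp only [Complex.mul_im, Complex.natCast_re, Complex.natCast_im, zero_mul, add_zero]
    exact mul_pos (by exact_mod_cast hn) z.2⟩

open Filter Topology Function

/-- Nontrivial linear combinations of the functions `q ↦ g (q ^ n)`, `n > 0`, do not vanish at
points accumulating at `0`, for `g` analytic and vanishing at `0` but not locally zero there. -/
theorem AnalyticAt.coeff_eq_zero_of_frequently_sum_comp_pow_eq_zero {ι : Type*} {g : ℂ → ℂ}
    (hg : AnalyticAt ℂ g 0) (hgz : g 0 = 0) (hg0 : ¬ ∀ᶠ q in 𝓝 0, g q = 0)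
    {φ : ι → ℕ} (hφ : Injective φ)
    (hφ0 : ∀ i, 0 < φ i) (s : Finset ι) (c : ι → ℂ)
    (h : ∃ᶠ q in 𝓝[≠] (0 : ℂ), ∑ i ∈ s, c i * g (q ^ φ i) = 0) : ∀ i ∈ s, c i = 0 := by
  classical
  by_contra! hc
  obtain ⟨r, u, hu, hu0, hgu⟩ := hg.exists_eventuallyEq_pow_smul_nonzero_iff.mpr hg0
  obtain ⟨j, hj, hmin⟩ := (s.filter (c · ≠ 0)).exists_min_image φ
    (hc.imp fun i hi => Finset.mem_filter.mpr hi)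
  obtain ⟨hjs, hcj⟩ := Finset.mem_filter.mp hj
  have hmin' : ∀ i ∈ s, c i ≠ 0 → φ j ≤ φ i := fun i hi hci =>
    hmin i (Finset.mem_filter.mpr ⟨hi, hci⟩)
  have hpow (i : ι) : Tendsto (fun q : ℂ => q ^ φ i) (𝓝 0) (𝓝 0) := by
    simpa [(hφ0 i).ne'] using (continuous_pow (M := ℂ) (φ i)).tendsto 0
  have hlim : Tendsto (fun q : ℂ => ∑ i ∈ s, c i * (q ^ (r * (φ i - φ j)) * u (q ^ φ i)))
      (𝓝 0) (𝓝 (∑ i ∈ s, c i * (0 ^ (r * (φ i - φ j)) * u 0))) :=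
    tendsto_finsetSum _ fun i _ => tendsto_const_nhds.mul
      (((continuous_pow _).tendsto 0).mul (hu.continuousAt.tendsto.comp (hpow i)))
  have hr : r ≠ 0 := by
    rintro rfl
    exact hu0 (by simpa [hgz] using hgu.self_of_nhds.symm)
  have hsum : ∑ i ∈ s, c i * (0 ^ (r * (φ i - φ j)) * u 0) = c j * u 0 := by
    rw [Finset.sum_eq_single_of_mem j hjs fun i hi hij => ?_]
    · simp
    · by_cases hci : c i = 0
      · simp [hci]
      · have hlt : φ j < φ i := (hmin' i hi hci).lt_of_ne (hφ.ne hij.symm)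
        simp [hr, Nat.sub_ne_zero_of_lt hlt]
  rw [hsum] at hlim
  have hne := (hlim.eventually_ne (mul_ne_zero hcj hu0)).filter_mono
    (nhdsWithin_le_nhds (s := {0}ᶜ))
  have hgu' : ∀ᶠ q in 𝓝[≠] (0 : ℂ), ∀ i ∈ s, g (q ^ φ i) = (q ^ φ i) ^ r * u (q ^ φ i) := by
    refine nhdsWithin_le_nhds ((Finset.eventually_all s).mpr fun i _ => ?_)
    simpa using (hpow i).eventually hgu
  obtain ⟨q, hq, hq1, hq2, hq0⟩ :=
    (h.and_eventually (hne.and (hgu'.and self_mem_nhdsWithin))).exists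
  refine hq1 ((mul_eq_zero.mp ?_).resolve_left (pow_ne_zero (r * φ j) hq0))
  rw [← hq, Finset.mul_sum]
  refine Finset.sum_congr rfl fun i hi => ?_
  by_cases hci : c i = 0
  · simp [hci]
  · rw [hq2 i hi, ← pow_mul, mul_comm (φ i) r]
    nth_rewrite 3 [← Nat.add_sub_of_le (hmin' i hi hci)]
    rw [mul_add, pow_add]
    ring

theorem CuspForm.not_eventually_cuspFunction_eq_zero {Γ : Subgroup (GL (Fin 2) ℝ)} {k : ℤ}
    {h : ℝ} (hh : 0 < h) (hΓ : h ∈ Γ.strictPeriods) {f : CuspForm Γ k} (hf : f ≠ 0) :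
    ¬ ∀ᶠ q in 𝓝 0, cuspFunction h f q = 0 := by
  intro H
  have hd : DifferentiableOn ℂ (cuspFunction h f) (Metric.ball 0 1) := fun q hq =>
    (ModularFormClass.differentiableAt_cuspFunction f hh hΓ
      (mem_ball_zero_iff.mp hq)).differentiableWithinAt
  have hz := (hd.analyticOnNhd Metric.isOpen_ball).eqOn_zero_of_preconnected_of_eventuallyEq_zero
    (convex_ball (0 : ℂ) 1).isPreconnected (Metric.mem_ball_self one_pos) H
  refine hf (DFunLike.ext _ _ fun τ => ?_)
  rw [← SlashInvariantFormClass.eq_cuspFunction f τ hΓ hh.ne']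
  exact hz (mem_ball_zero_iff.mpr (Periodic.norm_qParam_lt_one hh τ.im_pos))

/-- If `f` is a nonzero cusp form of weight `k` for `Γ₁(M)`, then for any finite set `S` of
distinct positive integers, the functions `τ ↦ f(n·τ)` for `n ∈ S` are linearly independent
over `ℂ`. -/
theorem linearIndependent_cuspForm_comp_scaleNat (M : ℕ) (hM : 0 < M) (k : ℤ) (hk : 0 < k)
    (f : CuspForm (Gamma1 M) k) (hf : f ≠ 0) (S : Finset ℕ) (hS : ∀ n ∈ S, 0 < n) :
    LinearIndependent ℂ
      (fun n : S => fun τ : UpperHalfPlane =>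
        f (UpperHalfPlane.scaleNat n.1 (hS n.1 n.2) τ)) := by
  have hΓ : (1 : ℝ) ∈ (Gamma1 M : Subgroup (GL (Fin 2) ℝ)).strictPeriods := by simp
  refine linearIndependent_iff'.mpr fun s c hc =>
    (ModularFormClass.analyticAt_cuspFunction_zero f one_pos
      hΓ).coeff_eq_zero_of_frequently_sum_comp_pow_eq_zero
      (CuspFormClass.cuspFunction_apply_zero f one_pos hΓ)
      (CuspForm.not_eventually_cuspFunction_eq_zero one_pos hΓ hf)
      Subtype.val_injective (fun n => hS n.1 n.2) s c ?_
  have hq : Tendsto (fun τ : ℍ => Periodic.qParam 1 τ) atImInfty (𝓝[≠] 0) :=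
    (Periodic.qParam_tendsto one_pos).comp tendsto_coe_atImInfty
  refine hq.frequently (Eventually.of_forall fun τ => ?_).frequently
  have hτ := congrFun hc τ
  simp only [Finset.sum_apply, Pi.smul_apply, smul_eq_mul, Pi.zero_apply] at hτ
  rw [← hτ]
  refine Finset.sum_congr rfl fun n _ => ?_
  rw [← SlashInvariantFormClass.eq_cuspFunction f _ hΓ one_ne_zero]
  congr 2
  simp only [Periodic.qParam, UpperHalfPlane.scaleNat, ← Complex.exp_nat_mul]
  congr 1
  push_cast
  ring
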